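/- Let q, k, p be real numbers with 1 < q < k < p, let δ ≥ 1 and λ > 0, and set t* := (λ·δ^(−k)·p·(k−q)/(k·(p−q)))^(1/(p−k)) and h(t) = δ^q/q − λ·δ^(−k)·t^(k−q)/k + t^(p−q)/p. Then h(t*) < 0 if and only if λ > λ_δ, where λ_δ := δ^(q·(p−k)/(p−q) + k) · (k·(p−q)) / ((p−k)^((p−k)/(p−q)) · (k−q)^((k−q)/(p−q))) · q^(−(p−k)/(p−q)) · p^((q−k)/(p−q)). -/

import Mathlib

/-- Computation of the threshold λ_j (display (3.10), proof of Lemma 3.2). -/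
theorem stmt_10 (q k p : ℝ) (hq : 1 < q) (hqk : q < k) (hkp : k < p)
    (δ lam : ℝ) (hδ : 1 ≤ δ) (hlam : 0 < lam)
    (tstar : ℝ)
    (htstar : tstar = (lam * δ ^ (-k) * p * (k - q) / (k * (p - q))) ^ (1 / (p - k)))
    (h : ℝ → ℝ)
    (hh : ∀ t, h t = δ ^ q / q - lam * δ ^ (-k) * t ^ (k - q) / k + t ^ (p - q) / p) :
    h tstar < 0 ↔
      δ ^ (q * (p - k) / (p - q) + k) * (k * (p - q)) /
          ((p - k) ^ ((p - k) / (p - q)) * (k - q) ^ ((k - q) / (p - q))) *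
          q ^ (-(p - k) / (p - q)) * p ^ ((q - k) / (p - q)) < lam := by
  have hδ0 : 0 < δ := by linarith
  have hq0 : 0 < q := by linarith
  have hk0 : 0 < k := by linarith
  have hp0 : 0 < p := by linarith
  have hkq : 0 < k - q := by linarith
  have hpk : 0 < p - k := by linarith
  have hpq : 0 < p - q := by linarith
  set A := lam * δ ^ (-k) * p * (k - q) / (k * (p - q)) with hA
  have hA0 : 0 < A := by positivity
  have ht0 : 0 < tstar := by rw [htstar]; positivity
  have htA : tstar ^ (p - k) = A := by
    rw [htstar, ← Real.rpow_mul hA0.le, one_div_mul_cancel hpk.ne', Real.rpow_one]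
  have hsplit : tstar ^ (p - q) = tstar ^ (k - q) * A := by
    rw [← htA, ← Real.rpow_add ht0]; congr 1; ring
  have hval : h tstar =
      (p - k) / (p * (k - q)) * (δ ^ q * (p * (k - q)) / (q * (p - k)) - tstar ^ (p - q)) := by
    have hl : lam * δ ^ (-k) = A * (k * (p - q)) / (p * (k - q)) := by
      rw [hA]; field_simp
    rw [hh, hl, hsplit]
    field_simp
    ring
  set B := δ ^ q * (p * (k - q)) / (q * (p - k)) with hB
  have hB0 : 0 < B := by positivity
  have hneg : h tstar < 0 ↔ B < tstar ^ (p - q) := by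
    rw [hval, ← sub_neg (a := B)]
    have hc : 0 < (p - k) / (p * (k - q)) := by positivity
    exact ⟨fun hn => (pos_iff_neg_of_mul_neg hn).mp hc, mul_neg_of_pos_of_neg hc⟩
  have hroot : (tstar ^ (p - q)) ^ ((p - k) / (p - q)) = A := by
    rw [← Real.rpow_mul ht0.le, mul_div_cancel₀ _ hpq.ne', htA]
  have ha : 0 < (p - k) / (p - q) := by positivity
  rw [hneg, ← Real.rpow_lt_rpow_iff hB0.le (by positivity) ha, hroot]
  have hAdiv : A = lam / (δ ^ k * (k * (p - q)) / (p * (k - q))) := by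
    rw [hA, Real.rpow_neg hδ0.le]; field_simp
  rw [hAdiv, lt_div_iff₀ (by positivity)]
  apply iff_of_eq
  congr 1
  have e1 : (k - q) / (p - q) = 1 - (p - k) / (p - q) := by field_simp; ring
  have e2 : (q - k) / (p - q) = (p - k) / (p - q) - 1 := by field_simp; ring
  rw [hB, Real.div_rpow (by positivity) (by positivity), Real.mul_rpow (by positivity)
    (by positivity), Real.mul_rpow hp0.le hkq.le, Real.mul_rpow hq0.le hpk.le,
    ← Real.rpow_mul hδ0.le, Real.rpow_add hδ0, neg_div, Real.rpow_neg hq0.le, e1, e2,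
    Real.rpow_sub hkq, Real.rpow_sub hp0, Real.rpow_one, Real.rpow_one, mul_div_assoc q]
  generalize (p - k) / (p - q) = a
  field_simp
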